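/- Suppose u, v : ℝⁿ → ℝⁿ (n = 2, 3, or 4) are Schwartz functions satisfying u - α²Δu = v with α > 0. Then there is a constant C depending only on α and n such that ‖u‖_{Lⁿ}² + ‖∇u‖_{Lⁿ}² ≤ C‖v‖_{L²}². -/

import Mathlib

open MeasureTheory

/-- Laplacian of a vector field on `ℝⁿ` (Euclidean space). -/
noncomputable def vlap {n : ℕ} (f : EuclideanSpace ℝ (Fin n) → EuclideanSpace ℝ (Fin n))
    (x : EuclideanSpace ℝ (Fin n)) : EuclideanSpace ℝ (Fin n) :=
  ∑ i, iteratedFDeriv ℝ 2 f x (fun _ => EuclideanSpace.single i 1)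

open scoped SchwartzMap LineDeriv ENNReal NNReal

lemma aux_interp {α F : Type*} [MeasurableSpace α] {μ : Measure α} [NormedAddCommGroup F]
    {h : α → F} (hh : AEStronglyMeasurable h μ) :
    eLpNorm h 3 μ ≤ eLpNorm h 2 μ + eLpNorm h 6 μ := by
  set A := eLpNorm h 2 μ + eLpNorm h 6 μ with hA
  have e (k : ℕ) (hk : k ≠ 0) : ∫⁻ x, ‖h x‖ₑ ^ k ∂μ = eLpNorm h k μ ^ k := by
    rw [eLpNorm_eq_lintegral_rpow_enorm_toReal (by exact_mod_cast hk) (by simp)]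
    rw [← ENNReal.rpow_natCast, ← ENNReal.rpow_mul]
    simp [hk]
  have e2 : ∫⁻ x, ‖h x‖ₑ ^ 2 ∂μ ≤ A ^ 2 := by
    rw [e 2 (by norm_num)]; gcongr; exact le_self_add
  have e6 : ∫⁻ x, ‖h x‖ₑ ^ 6 ∂μ ≤ A ^ 6 := by
    rw [e 6 (by norm_num)]; gcongr; exact le_add_self
  have e3 := e 3 (by norm_num)
  have key := ENNReal.lintegral_mul_norm_pow_le (μ := μ) (f := fun x => ‖h x‖ₑ ^ 2)
    (g := fun x => ‖h x‖ₑ ^ 6) (hh.enorm.pow_const 2) (hh.enorm.pow_const 6)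
    (p := 3/4) (q := 1/4) (by norm_num) (by norm_num) (by norm_num)
  have pw (a : ℝ≥0∞) : (a ^ 2) ^ (3/4 : ℝ) * (a ^ 6) ^ (1/4 : ℝ) = a ^ 3 := by
    rw [← ENNReal.rpow_natCast, ← ENNReal.rpow_natCast, ← ENNReal.rpow_natCast,
      ← ENNReal.rpow_mul, ← ENNReal.rpow_mul, ← ENNReal.rpow_add_of_nonneg _ _ (by norm_num) (by norm_num)]
    norm_num
  simp_rw [pw] at key
  rw [e3] at key
  have : eLpNorm h 3 μ ^ 3 ≤ A ^ 3 := by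
    rw [← pw A]
    refine key.trans ?_
    gcongr
  exact (ENNReal.pow_le_pow_left_iff (by norm_num)).1 this

/-- Hilbert space algebra. -/
lemma aux_hilb {H ι : Type*} [NormedAddCommGroup H] [InnerProductSpace ℝ H] [Fintype ι]
    (a : ℝ) (u v : H) (d : ι → H) (D : ι → ι → H)
    (h1 : ∀ i, inner ℝ u (D i i) = - ‖d i‖ ^ 2)
    (h2 : ∀ i j, inner ℝ (D i i) (D j j) = ‖D i j‖ ^ 2)
    (hv : u - a • ∑ i, D i i = v) :
    ‖v‖ ^ 2 = ‖u‖ ^ 2 + 2 * a * ∑ i, ‖d i‖ ^ 2 + a ^ 2 * ∑ i, ∑ j, ‖D i j‖ ^ 2 := by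
  rw [← hv, norm_sub_sq_real, norm_smul, inner_smul_right, inner_sum, mul_pow,
    ← real_inner_self_eq_norm_sq (∑ i, D i i), sum_inner]
  simp_rw [inner_sum, h1, h2]
  simp
  ring

section
variable {n : ℕ}
local notation "𝔼" => EuclideanSpace ℝ (Fin n)

/-- A Schwartz field as an element of `L²`. -/
noncomputable def auxL (f : 𝓢(𝔼, 𝔼)) : Lp 𝔼 2 (volume : Measure 𝔼) := f.toLp 2 volume

lemma auxL_norm (f : 𝓢(𝔼, 𝔼)) : ‖auxL f‖ = (eLpNorm f 2 volume).toReal :=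
  SchwartzMap.norm_toLp

lemma auxL_fin (f : 𝓢(𝔼, 𝔼)) : eLpNorm f 2 (volume : Measure 𝔼) ≠ ∞ :=
  (f.eLpNorm_lt_top 2 volume).ne

lemma aux_inner (f g : 𝓢(𝔼, 𝔼)) :
    inner ℝ (auxL f) (auxL g) = ∫ x, inner ℝ (f x) (g x) := by
  unfold auxL
  rw [L2.inner_def]
  apply integral_congr_ae
  filter_upwards [f.coeFn_toLp 2, g.coeFn_toLp 2] with x h1 h2
  rw [h1, h2]

lemma aux_ibp (f g : 𝓢(𝔼, 𝔼)) (w : 𝔼) :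
    inner ℝ (auxL f) (auxL (∂_{w} g)) = - inner ℝ (auxL (∂_{w} f)) (auxL g) := by
  rw [aux_inner, aux_inner]
  exact SchwartzMap.integral_bilinear_lineDerivOp_right_eq_neg_left f g (innerSL ℝ) w

/-- Partial derivative of a Schwartz field. -/
noncomputable def auxPd (i : Fin n) (f : 𝓢(𝔼, 𝔼)) : 𝓢(𝔼, 𝔼) := ∂_{EuclideanSpace.single i (1:ℝ)} f

lemma auxPd_apply (i : Fin n) (f : 𝓢(𝔼, 𝔼)) (x : 𝔼) :
    auxPd i f x = fderiv ℝ f x (EuclideanSpace.single i (1:ℝ)) := rfl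

lemma auxPd_ibp (f g : 𝓢(𝔼, 𝔼)) (i : Fin n) :
    inner ℝ (auxL f) (auxL (auxPd i g)) = - inner ℝ (auxL (auxPd i f)) (auxL g) :=
  aux_ibp f g _

lemma auxPd_pd (i j : Fin n) (f : 𝓢(𝔼, 𝔼)) (x : 𝔼) :
    auxPd i (auxPd j f) x = iteratedFDeriv ℝ 2 f x
      ![EuclideanSpace.single i (1:ℝ), EuclideanSpace.single j (1:ℝ)] := by
  rw [← SchwartzMap.iteratedLineDerivOp_eq_iteratedFDeriv]
  rfl

lemma auxPd_comm (f : 𝓢(𝔼, 𝔼)) (i j : Fin n) : auxPd i (auxPd j f) = auxPd j (auxPd i f) := by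
  ext1 x
  rw [auxPd_pd, auxPd_pd]
  have h : IsSymmSndFDerivAt ℝ f x := (f.smooth 2).contDiffAt.isSymmSndFDerivAt (by simp)
  simpa [iteratedFDeriv_two_apply] using h _ _

lemma auxPd_toLp (u v : 𝓢(𝔼, 𝔼)) (α : ℝ) (h : ∀ x, u x - α ^ 2 • vlap (⇑u) x = v x) :
    auxL u - α ^ 2 • ∑ i, auxL (auxPd i (auxPd i u)) = auxL v := by
  have : v = u - α ^ 2 • ∑ i, auxPd i (auxPd i u) := by
    ext1 x
    rw [← h x, vlap]
    simp only [sub_apply, smul_apply, sum_apply, auxPd_pd]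
    congr! 4 with i
    ext1 k
    fin_cases k <;> rfl
  rw [this]
  change _ = SchwartzMap.toLpCLM ℝ 𝔼 2 volume (u - _)
  rw [map_sub, map_smul, map_sum]
  rfl

lemma aux_energy (u v : 𝓢(𝔼, 𝔼)) (α : ℝ) (h : ∀ x, u x - α ^ 2 • vlap (⇑u) x = v x) :
    ‖auxL v‖ ^ 2 = ‖auxL u‖ ^ 2 + 2 * α ^ 2 * ∑ i, ‖auxL (auxPd i u)‖ ^ 2
      + (α ^ 2) ^ 2 * ∑ i, ∑ j, ‖auxL (auxPd i (auxPd j u))‖ ^ 2 := by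
  refine aux_hilb (α ^ 2) (auxL u) (auxL v) (fun i => auxL (auxPd i u))
    (fun i j => auxL (auxPd i (auxPd j u))) ?_ ?_ (auxPd_toLp u v α h)
  · intro i
    rw [auxPd_ibp, real_inner_self_eq_norm_sq]
  · intro i j
    rw [auxPd_ibp, real_inner_comm, auxPd_comm (auxPd i u) j i, auxPd_ibp, neg_neg,
      auxPd_comm u j i, real_inner_self_eq_norm_sq]

lemma aux_real {ι : Type*} [Fintype ι] (α K U V : ℝ) (d : ι → ℝ) (D : ι → ι → ℝ) (hα : 0 < α)
    (hKr : K = 1 + 1 / α + 1 / α ^ 2) (hU : 0 ≤ U) (hV : 0 ≤ V) (hd : ∀ i, 0 ≤ d i)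
    (hD : ∀ i j, 0 ≤ D i j)
    (en : V ^ 2 = U ^ 2 + 2 * α ^ 2 * ∑ i, d i ^ 2 + (α ^ 2) ^ 2 * ∑ i, ∑ j, D i j ^ 2) :
    U ≤ K * V ∧ (∀ i, d i ≤ K * V) ∧ (∀ i j, D i j ≤ K * V) := by
  have p1 : 0 < 1 / α := by positivity
  have p2 : 0 < 1 / α ^ 2 := by positivity
  have hK0 : 0 ≤ K := by rw [hKr]; positivity
  have gen (a b c : ℝ) (ha : 0 ≤ a) (hb : 0 ≤ b) (hc : 0 < c) (hcK : 1 / c ≤ K)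
      (hh : (c * a) ^ 2 ≤ b ^ 2) : a ≤ K * b := by
    have h1 : c * a ≤ b := by
      exact (sq_le_sq₀ (by positivity) hb).1 hh
    calc a = 1 / c * (c * a) := by field_simp
      _ ≤ K * b := by gcongr
  have s1 : 0 ≤ α ^ 2 * ∑ i, d i ^ 2 := by positivity
  have s2 : 0 ≤ (α ^ 2) ^ 2 * ∑ i, ∑ j, D i j ^ 2 := by positivity
  have s0 := sq_nonneg U
  refine ⟨?_, fun i => ?_, fun i j => ?_⟩
  · refine gen _ _ 1 hU hV one_pos (by rw [hKr]; linarith) ?_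
    rw [en, one_mul]
    linarith
  · refine gen _ _ α (hd i) hV hα (by rw [hKr]; linarith) ?_
    rw [en, mul_pow]
    have h0 : d i ^ 2 ≤ ∑ i, d i ^ 2 :=
      Finset.single_le_sum (f := fun i => d i ^ 2)
        (fun _ _ => sq_nonneg _) (Finset.mem_univ i)
    have := mul_le_mul_of_nonneg_left h0 (sq_nonneg α)
    linarith
  · refine gen _ _ (α ^ 2) (hD i j) hV (by positivity) (by rw [hKr]; linarith) ?_
    rw [en, mul_pow]
    have h0 : D i j ^ 2 ≤ ∑ j, D i j ^ 2 :=
      Finset.single_le_sum (f := fun j => D i j ^ 2)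
        (fun _ _ => sq_nonneg _) (Finset.mem_univ j)
    have h1 : ∑ j, D i j ^ 2 ≤ ∑ i, ∑ j, D i j ^ 2 :=
      Finset.single_le_sum (f := fun i => ∑ j, D i j ^ 2)
        (fun _ _ => by positivity) (Finset.mem_univ i)
    have := mul_le_mul_of_nonneg_left (h0.trans h1) (sq_nonneg (α ^ 2))
    linarith

lemma aux_l2 (u v : 𝓢(𝔼, 𝔼)) (α : ℝ) (hα : 0 < α) (h : ∀ x, u x - α ^ 2 • vlap (⇑u) x = v x)
    (K : ℝ≥0) (hKr : (K : ℝ) = 1 + 1 / α + 1 / α ^ 2) :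
    eLpNorm u 2 volume ≤ K * eLpNorm v 2 volume ∧
    (∀ i, eLpNorm (auxPd i u) 2 volume ≤ K * eLpNorm v 2 volume) ∧
    (∀ i j, eLpNorm (auxPd i (auxPd j u)) 2 volume ≤ K * eLpNorm v 2 volume) := by
  have conv (f : 𝓢(𝔼, 𝔼)) (hf : ‖auxL f‖ ≤ K * ‖auxL v‖) :
      eLpNorm f 2 volume ≤ K * eLpNorm v 2 volume := by
    rw [auxL_norm, auxL_norm] at hf
    rw [← ENNReal.toReal_le_toReal (auxL_fin f)
      (ENNReal.mul_ne_top ENNReal.coe_ne_top (auxL_fin v))]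
    simpa using hf
  obtain ⟨h0, h1, h2⟩ := aux_real α K ‖auxL u‖ ‖auxL v‖ (fun i => ‖auxL (auxPd i u)‖)
    (fun i j => ‖auxL (auxPd i (auxPd j u))‖) hα hKr (norm_nonneg _) (norm_nonneg _)
    (fun _ => norm_nonneg _) (fun _ _ => norm_nonneg _) (aux_energy u v α h)
  exact ⟨conv _ h0, fun i => conv _ (h1 i), fun i j => conv _ (h2 i j)⟩

/-- The operator norm is bounded by the sum of partial derivatives. -/
lemma aux_opnorm (L : 𝔼 →L[ℝ] 𝔼) : ‖L‖ ≤ ∑ i, ‖L (EuclideanSpace.single i (1:ℝ))‖ := by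
  refine L.opNorm_le_bound (by positivity) fun x => ?_
  have hx : x = ∑ i, x i • EuclideanSpace.single i (1:ℝ) := by
    ext j
    simp [Finset.sum_apply, Pi.single_apply]
  conv_lhs => rw [hx]
  rw [map_sum, Finset.sum_mul]
  refine (norm_sum_le _ _).trans (Finset.sum_le_sum fun i _ => ?_)
  rw [map_smul, norm_smul, mul_comm]
  gcongr
  exact PiLp.norm_apply_le x i

lemma aux_fderiv (f : 𝓢(𝔼, 𝔼)) (p : ℝ≥0∞) (hp : 1 ≤ p) :
    eLpNorm (fun x => fderiv ℝ f x) p volume ≤ ∑ i, eLpNorm (auxPd i f) p volume := by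
  calc eLpNorm (fun x => fderiv ℝ f x) p volume
      ≤ eLpNorm (∑ i, fun x => ‖auxPd i f x‖) p volume := by
        refine eLpNorm_mono_real fun x => ?_
        rw [Finset.sum_apply]
        exact aux_opnorm _
    _ ≤ ∑ i, eLpNorm (fun x => ‖auxPd i f x‖) p volume :=
        eLpNorm_sum_le (fun i _ => (auxPd i f).continuous.norm.aestronglyMeasurable) hp
    _ = _ := by simp_rw [eLpNorm_norm]

lemma aux_sob (p' : ℝ≥0) (hn : 0 < n) (hp' : (p' : ℝ)⁻¹ = 2⁻¹ - (n : ℝ)⁻¹) :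
    ∃ K : ℝ≥0, ∀ f : 𝓢(𝔼, 𝔼), eLpNorm f p' volume ≤
      K * (eLpNorm f 2 volume + eLpNorm (fun x => fderiv ℝ f x) 2 volume) := by
  let χ : ContDiffBump (0 : 𝔼) := ⟨1, 2, one_pos, one_lt_two⟩
  have hχ : ContDiff ℝ 1 χ := χ.contDiff
  obtain ⟨M, hM⟩ := (χ.hasCompactSupport.fderiv (𝕜 := ℝ)).exists_bound_of_continuous
    (hχ.continuous_fderiv one_ne_zero)
  have hM0 : 0 ≤ M := (norm_nonneg _).trans (hM 0)
  lift M to ℝ≥0 using hM0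
  obtain ⟨K0, hK0⟩ : ∃ K0 : ℝ≥0, K0 = SNormLESNormFDerivOfEqConst 𝔼 (volume : Measure 𝔼) 2 := ⟨_, rfl⟩
  refine ⟨K0 * (1 + M), fun f => ?_⟩
  let c : ℕ → ℝ := fun k => ((k : ℝ) + 1)⁻¹
  have hc0 (k) : 0 < c k := by positivity
  have hc1 (k) : c k ≤ 1 := inv_le_one_of_one_le₀ (by simp)
  let g : ℕ → 𝔼 → 𝔼 := fun k x => χ (c k • x) • f x
  have hχc (k) : ContDiff ℝ 1 (fun x => χ (c k • x)) := hχ.comp (contDiff_const_smul _)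
  have hg (k) : ContDiff ℝ 1 (g k) := (hχc k).smul (f.smooth 1)
  have hgs (k) : HasCompactSupport (g k) := by
    have : HasCompactSupport (fun x : 𝔼 => χ (c k • x)) :=
      χ.hasCompactSupport.comp_homeomorph (Homeomorph.smulOfNeZero (c k) (hc0 k).ne')
    exact this.smul_right
  have hgd (k x) : ‖fderiv ℝ (g k) x‖ ≤ ‖fderiv ℝ f x‖ + M * ‖f x‖ := by
    have d1 : HasFDerivAt (fun x => χ (c k • x))
        ((fderiv ℝ χ (c k • x)).comp (c k • ContinuousLinearMap.id ℝ 𝔼)) x :=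
      ((hχ.differentiable one_ne_zero _).hasFDerivAt).comp x ((hasFDerivAt_id x).const_smul (c k))
    have d2 := d1.smul (f.hasFDerivAt x)
    rw [show fderiv ℝ (g k) x = _ from d2.fderiv]
    refine (norm_add_le _ _).trans ?_
    gcongr
    · rw [norm_smul]
      refine mul_le_of_le_one_left (norm_nonneg _) ?_
      rw [Real.norm_of_nonneg χ.nonneg]
      exact χ.le_one
    · rw [ContinuousLinearMap.norm_smulRight_apply]
      gcongr
      rw [ContinuousLinearMap.comp_smul, ContinuousLinearMap.comp_id, norm_smul,
        Real.norm_of_nonneg (hc0 k).le]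
      calc c k * _ ≤ 1 * M := by gcongr; exacts [hc1 k, hM _]
        _ = M := one_mul _
  have bound (k) : eLpNorm (g k) p' volume ≤ K0 *
      (eLpNorm (fun x => fderiv ℝ f x) 2 volume + (M : ℝ≥0∞) * eLpNorm f 2 volume) := by
    have h1 := eLpNorm_le_eLpNorm_fderiv_of_eq (volume : Measure 𝔼) (hg k) (hgs k)
      (p := 2) (p' := p') (by norm_num) (by simpa using hn) (by simpa using hp')
    rw [NNReal.coe_ofNat, ← hK0] at h1
    refine h1.trans ?_
    gcongr
    calc eLpNorm (fderiv ℝ (g k)) 2 volume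
        ≤ eLpNorm ((fun x => ‖fderiv ℝ f x‖) + (fun x => M * ‖f x‖)) 2 volume :=
          eLpNorm_mono_real fun x => hgd k x
      _ ≤ eLpNorm (fun x => ‖fderiv ℝ f x‖) 2 volume + eLpNorm (fun x => M * ‖f x‖) 2 volume :=
          eLpNorm_add_le ((f.smooth 1).continuous_fderiv one_ne_zero).norm.aestronglyMeasurable
            (continuous_const.mul f.continuous.norm).aestronglyMeasurable (by norm_num)
      _ = _ := by
          rw [eLpNorm_norm]
          congr 1
          have := eLpNorm_const_smul (M : ℝ) (fun x => ‖f x‖) 2 (volume : Measure 𝔼)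
          rw [eLpNorm_norm, Real.enorm_of_nonneg M.coe_nonneg, ENNReal.ofReal_coe_nnreal] at this
          exact this
  have lim : ∀ x, Filter.Tendsto (fun k => g k x) Filter.atTop (nhds (f x)) := by
    intro x
    refine tendsto_const_nhds.congr' ?_
    filter_upwards [Filter.eventually_ge_atTop ⌈‖x‖⌉₊] with k hk
    have hk' : ‖x‖ ≤ k := (Nat.le_ceil _).trans (by exact_mod_cast hk)
    have : χ (c k • x) = 1 := by
      apply χ.one_of_mem_closedBall
      rw [mem_closedBall_zero_iff, norm_smul, Real.norm_of_nonneg (hc0 k).le]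
      change ((k : ℝ) + 1)⁻¹ * ‖x‖ ≤ 1
      rw [inv_mul_le_iff₀ (by positivity)]
      linarith
    simp [g, this]
  have fatou := Lp.eLpNorm_lim_le_liminf_eLpNorm (p := (p' : ℝ≥0∞)) (μ := (volume : Measure 𝔼))
    (fun k => (hg k).continuous.aestronglyMeasurable) f (Filter.Eventually.of_forall lim)
  refine fatou.trans ?_
  refine (Filter.liminf_le_of_le (by isBoundedDefault) (a := K0 *
      (eLpNorm (fun x => fderiv ℝ f x) 2 volume + (M : ℝ≥0∞) * eLpNorm f 2 volume)) ?_).trans ?_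
  · intro b hb
    obtain ⟨k, hk⟩ := hb.exists
    exact hk.trans (bound k)
  · rw [ENNReal.coe_mul, mul_assoc]
    gcongr
    push_cast
    rw [mul_add, add_comm]
    gcongr
    · exact le_add_self
    · exact le_mul_of_one_le_left' le_self_add

lemma aux_sobn (hn : n = 2 ∨ n = 3 ∨ n = 4) :
    ∃ K : ℝ≥0, ∀ f : 𝓢(𝔼, 𝔼), eLpNorm f n volume ≤
      K * (eLpNorm f 2 volume + ∑ i, eLpNorm (auxPd i f) 2 volume) := by
  suffices ∃ K : ℝ≥0, ∀ f : 𝓢(𝔼, 𝔼), eLpNorm f n volume ≤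
      K * (eLpNorm f 2 volume + eLpNorm (fun x => fderiv ℝ f x) 2 volume) by
    obtain ⟨K, hK⟩ := this
    refine ⟨K, fun f => (hK f).trans ?_⟩
    gcongr
    exact aux_fderiv f 2 (by norm_num)
  rcases hn with rfl | rfl | rfl
  · refine ⟨1, fun f => ?_⟩
    simp
  · obtain ⟨K, hK⟩ := aux_sob (n := 3) 6 (by norm_num) (by norm_num)
    refine ⟨1 + K, fun f => ?_⟩
    refine (aux_interp f.continuous.aestronglyMeasurable).trans ?_
    push_cast
    rw [add_mul, one_mul]
    gcongr
    · exact le_self_add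
    · exact hK f
  · exact aux_sob (n := 4) 4 (by norm_num) (by norm_num)

end

theorem stmt4 (n : ℕ) (hn : n = 2 ∨ n = 3 ∨ n = 4) (α : ℝ) (hα : 0 < α) :
    ∃ C > 0, ∀ (u v : SchwartzMap (EuclideanSpace ℝ (Fin n)) (EuclideanSpace ℝ (Fin n))),
      (∀ x, u x - α ^ 2 • vlap (⇑u) x = v x) →
      (eLpNorm (⇑u) n volume).toReal ^ 2
        + (eLpNorm (fun x => fderiv ℝ (⇑u) x) n volume).toReal ^ 2
        ≤ C * (eLpNorm (⇑v) 2 volume).toReal ^ 2 := by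
  obtain ⟨K, hK⟩ := aux_sobn hn
  have hn1 : (1 : ℝ≥0∞) ≤ n := by
    have : 1 ≤ n := by omega
    exact_mod_cast this
  obtain ⟨L, hL⟩ : ∃ L : ℝ≥0, (L : ℝ) = 1 + 1 / α + 1 / α ^ 2 :=
    ⟨Real.toNNReal (1 + 1 / α + 1 / α ^ 2), Real.coe_toNNReal _ (by positivity)⟩
  obtain ⟨A, hA⟩ : ∃ A : ℝ≥0, A = K * (L + n * L) := ⟨_, rfl⟩
  obtain ⟨B, hB⟩ : ∃ B : ℝ≥0, B = n * A := ⟨_, rfl⟩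
  refine ⟨(A : ℝ) ^ 2 + (B : ℝ) ^ 2 + 1, by positivity, fun u v h => ?_⟩
  obtain ⟨l0, l1, l2⟩ := aux_l2 u v α hα h L hL
  have real (x : ℝ≥0∞) (D : ℝ≥0) (hx : x ≤ D * eLpNorm v 2 volume) :
      x.toReal ^ 2 ≤ (D : ℝ) ^ 2 * (eLpNorm v 2 volume).toReal ^ 2 := by
    have := ENNReal.toReal_mono (ENNReal.mul_ne_top ENNReal.coe_ne_top (auxL_fin v)) hx
    rw [ENNReal.toReal_mul, ENNReal.coe_toReal] at this
    rw [← mul_pow]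
    gcongr
  have b (f : 𝓢(EuclideanSpace ℝ (Fin n), EuclideanSpace ℝ (Fin n)))
      (h0 : eLpNorm f 2 volume ≤ L * eLpNorm v 2 volume)
      (h1 : ∀ i, eLpNorm (auxPd i f) 2 volume ≤ L * eLpNorm v 2 volume) :
      eLpNorm f n volume ≤ A * eLpNorm v 2 volume := by
    refine (hK f).trans ?_
    have : ∑ i, eLpNorm (auxPd i f) 2 volume ≤ n * (L * eLpNorm v 2 volume) := by
      refine (Finset.sum_le_sum fun i _ => h1 i).trans ?_
      simp
    have e : (A : ℝ≥0∞) * eLpNorm v 2 volume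
        = K * (L * eLpNorm v 2 volume + n * (L * eLpNorm v 2 volume)) := by
      rw [hA]; push_cast; ring
    rw [e]
    gcongr
  have r1 := real _ A (b u l0 l1)
  have r2 := real (eLpNorm (fun x => fderiv ℝ (⇑u) x) n volume) B (by
    refine (aux_fderiv u n hn1).trans ?_
    refine (Finset.sum_le_sum fun i _ => b (auxPd i u) (l1 i) (fun j => l2 j i)).trans ?_
    simp [hB, mul_assoc])
  have := sq_nonneg (eLpNorm v 2 volume).toReal
  linarith
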